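/- For every α > (ln 2)/(2π), ∫_0^{π/2} (sin 2x · sinh(x/α)) / (cosh(x/α) - cos(ln(2 cos x)/α)) dx = π/(24α) + 13πα/24 + πα/(2(e^{2πα} - 1)) - (πα/8)·Σ_{n=1}^∞ 1/sinh²(παn). -/

import Mathlib

open Real

open MeasureTheory Filter Topology Set

/-- `1 / (log (1 + z) - c)`, extended continuously by `0` to `z = -1`. -/
noncomputable def logKernel (c : ℝ) (z : ℂ) : ℂ :=
  if z = -1 then 0 else (Complex.log (1 + z) - c)⁻¹

lemma logKernel_eventuallyEq {c : ℝ} {z : ℂ} (hz : z ≠ -1) :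
    logKernel c =ᶠ[𝓝 z] fun w => (Complex.log (1 + w) - c)⁻¹ := by
  filter_upwards [isOpen_ne.mem_nhds hz] with w hw
  simp only [logKernel, if_neg hw]

lemma continuousAt_logKernel_neg_one (c : ℝ) : ContinuousAt (logKernel c) (-1) := by
  rw [continuousAt_iff_punctured_nhds]
  have h0 : logKernel c (-1) = 0 := by simp [logKernel]
  rw [h0]
  have h1 : Tendsto (fun z : ℂ => (Complex.log (1 + z) - c)⁻¹) (𝓝[≠] (-1)) (𝓝 0) := by
    apply tendsto_inv₀_cobounded.comp
    rw [← tendsto_norm_atTop_iff_cobounded]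
    have h2 : Tendsto (fun z : ℂ => ‖1 + z‖) (𝓝[≠] (-1)) (𝓝[≠] 0) := by
      apply tendsto_nhdsWithin_iff.2 ⟨?_, ?_⟩
      · have : Tendsto (fun z : ℂ => ‖1 + z‖) (𝓝 (-1)) (𝓝 ‖(1:ℂ) + -1‖) :=
          Continuous.tendsto (by fun_prop) _
        simpa using this.mono_left nhdsWithin_le_nhds
      · filter_upwards [self_mem_nhdsWithin] with z hz
        simp only [mem_compl_iff, mem_singleton_iff, norm_eq_zero] at hz ⊢
        intro h
        exact hz (by linear_combination h)
    have h3 : Tendsto (fun z : ℂ => -(Real.log ‖1 + z‖ - c)) (𝓝[≠] (-1)) atTop := by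
      apply tendsto_neg_atBot_atTop.comp
      exact tendsto_atBot_add_const_right _ (-c) (Real.tendsto_log_nhdsNE_zero.comp h2)
    refine tendsto_atTop_mono (fun z => ?_) h3
    calc -(Real.log ‖1 + z‖ - c) ≤ |(Complex.log (1 + z) - c).re| := by
          rw [Complex.sub_re, Complex.log_re, Complex.ofReal_re]; exact neg_le_abs _
      _ ≤ _ := Complex.abs_re_le_norm _
  refine h1.congr' ?_
  filter_upwards [self_mem_nhdsWithin] with z hz
  simp only [logKernel, if_neg (show z ≠ -1 from hz)]

lemma one_add_mem_slitPlane {z : ℂ} (hz : ‖z‖ ≤ 1) (h : z ≠ -1) : 1 + z ∈ Complex.slitPlane := by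
  rw [Complex.mem_slitPlane_iff]
  by_contra! hc
  have h1 := Complex.abs_re_le_norm z
  simp only [Complex.add_re, Complex.one_re, Complex.add_im, Complex.one_im, zero_add] at hc
  apply h
  apply Complex.ext
  · simp only [Complex.neg_re, Complex.one_re]
    linarith [neg_abs_le z.re]
  · simpa using hc.2

lemma eq_exp_sub_one_of_log_eq {z : ℂ} {c : ℝ} (h : z ≠ -1) (hc : Complex.log (1 + z) - c = 0) :
    z = (Real.exp c - 1 : ℝ) := by
  have h1 : 1 + z ≠ 0 := fun h' => h (by linear_combination h')
  have := Complex.exp_log h1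
  rw [sub_eq_zero.1 hc] at this
  push_cast
  linear_combination -this

lemma differentiableAt_logKernel {z : ℂ} {c : ℝ} (hz : ‖z‖ ≤ 1) (h : z ≠ -1)
    (hc : z ≠ (Real.exp c - 1 : ℝ)) : DifferentiableAt ℂ (logKernel c) z := by
  refine DifferentiableAt.congr_of_eventuallyEq ?_ (logKernel_eventuallyEq h)
  refine DifferentiableAt.inv ?_ fun h' => hc (eq_exp_sub_one_of_log_eq h h')
  exact ((differentiableAt_id.const_add 1).clog (one_add_mem_slitPlane hz h)).sub_const _

lemma ne_neg_one_of_norm_lt {z : ℂ} (hz : ‖z‖ < 1) : z ≠ -1 := by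
  rintro rfl
  simp at hz

lemma continuousAt_logKernel {z : ℂ} {c : ℝ} (hz : ‖z‖ ≤ 1)
    (hc : z ≠ (Real.exp c - 1 : ℝ)) : ContinuousAt (logKernel c) z := by
  by_cases h : z = -1
  · rw [h]; exact continuousAt_logKernel_neg_one c
  · exact (differentiableAt_logKernel hz h hc).continuousAt

lemma hasDerivAt_logKernel_zero {c : ℝ} (hc : c ≠ 0) :
    HasDerivAt (logKernel c) (-1 / (c : ℂ) ^ 2) 0 := by
  have hc' : (c : ℂ) ≠ 0 := by exact_mod_cast hc
  refine HasDerivAt.congr_of_eventuallyEq ?_ (logKernel_eventuallyEq (by norm_num))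
  have h1 : HasDerivAt (fun z : ℂ => Complex.log (1 + z) - c) (1 / (1 + 0)) 0 :=
    (((hasDerivAt_id (0:ℂ)).const_add 1).clog (by simp)).sub_const _
  exact (h1.fun_inv (by simpa using hc')).congr_deriv (by simp)

lemma logKernel_zero (c : ℝ) : logKernel c 0 = -(c : ℂ)⁻¹ := by
  simp [logKernel, inv_neg]

lemma diffContOnCl_logKernel {c : ℝ} (hc : Real.log 2 < c) :
    DiffContOnCl ℂ (logKernel c) (Metric.ball 0 1) := by
  have h2 : 2 < Real.exp c := (Real.log_lt_iff_lt_exp (by norm_num)).1 hc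
  have key : ∀ z : ℂ, ‖z‖ ≤ 1 → z ≠ (Real.exp c - 1 : ℝ) := by
    rintro z hz rfl
    rw [Complex.norm_real, Real.norm_eq_abs] at hz
    linarith [le_abs_self (Real.exp c - 1)]
  refine ⟨fun z hz => ?_, ?_⟩
  · rw [mem_ball_zero_iff] at hz
    exact (differentiableAt_logKernel hz.le (ne_neg_one_of_norm_lt hz)
      (key z hz.le)).differentiableWithinAt
  · rw [closure_ball _ one_ne_zero]
    intro z hz
    rw [mem_closedBall_zero_iff] at hz
    exact (continuousAt_logKernel hz (key z hz)).continuousWithinAt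

/-- `(z - p) / (log (1 + z) - c)` with `p = exp c - 1`, the singularity at `p` being removed. -/
noncomputable def logKernelReg (c : ℝ) : ℂ → ℂ :=
  Function.update (fun z => (z - (Real.exp c - 1 : ℝ)) * logKernel c z)
    ((Real.exp c - 1 : ℝ) : ℂ) (Real.exp c : ℂ)

lemma logKernelReg_eventuallyEq {c : ℝ} {z : ℂ} (hz : z ≠ (Real.exp c - 1 : ℝ)) :
    logKernelReg c =ᶠ[𝓝 z] fun z => (z - (Real.exp c - 1 : ℝ)) * logKernel c z := by
  filter_upwards [isOpen_ne.mem_nhds hz] with w hw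
  exact Function.update_of_ne hw _ _

lemma continuousAt_logKernelReg_self (c : ℝ) :
    ContinuousAt (logKernelReg c) ((Real.exp c - 1 : ℝ) : ℂ) := by
  rw [logKernelReg, continuousAt_update_same]
  set p : ℂ := ((Real.exp c - 1 : ℝ) : ℂ) with hp
  have hp1 : 1 + p = Complex.exp c := by rw [hp]; push_cast; ring
  have hlog : Complex.log (1 + p) = c := by
    rw [hp1, ← Complex.ofReal_exp, ← Complex.ofReal_log (Real.exp_pos c).le, Real.log_exp]
  have hd : HasDerivAt (fun z : ℂ => Complex.log (1 + z)) (1 / (1 + p)) p :=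
    ((hasDerivAt_id p).const_add 1).clog (by
      rw [id, hp1, ← Complex.ofReal_exp]
      exact Complex.ofReal_mem_slitPlane.2 (Real.exp_pos c))
  have h2 := (hasDerivAt_iff_tendsto_slope.1 hd).inv₀ (by rw [hp1]; simp)
  rw [one_div, inv_inv, hp1, ← Complex.ofReal_exp] at h2
  refine h2.congr' ?_
  have hne : p ≠ -1 := by
    intro h
    have : 1 + p ≠ 0 := by rw [hp1]; exact Complex.exp_ne_zero _
    exact this (by rw [h]; ring)
  filter_upwards [(logKernel_eventuallyEq (c := c) hne).filter_mono nhdsWithin_le_nhds] with z hz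
  rw [hz, slope_def_field, hlog, inv_div, div_eq_mul_inv]

lemma abs_exp_sub_one_lt {c : ℝ} (hc : c < 0) : ‖((Real.exp c - 1 : ℝ) : ℂ)‖ < 1 := by
  rw [Complex.norm_real, Real.norm_eq_abs, abs_lt]
  constructor <;> linarith [Real.exp_pos c, Real.exp_lt_one_iff.2 hc]

lemma diffContOnCl_logKernelReg {c : ℝ} (hc : c < 0) :
    DiffContOnCl ℂ (logKernelReg c) (Metric.ball 0 1) := by
  have hp := abs_exp_sub_one_lt hc
  constructor
  · rw [← Complex.differentiableOn_compl_singleton_and_continuousAt_iff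
      (Metric.isOpen_ball.mem_nhds (mem_ball_zero_iff.2 hp))]
    refine ⟨fun z hz => ?_, continuousAt_logKernelReg_self c⟩
    have hz1 := mem_ball_zero_iff.1 hz.1
    refine DifferentiableAt.differentiableWithinAt
      (DifferentiableAt.congr_of_eventuallyEq ?_ (logKernelReg_eventuallyEq hz.2))
    exact (differentiableAt_id.sub_const _).mul
      (differentiableAt_logKernel hz1.le (ne_neg_one_of_norm_lt hz1) hz.2)
  · rw [closure_ball _ one_ne_zero]
    intro z hz
    rw [mem_closedBall_zero_iff] at hz
    apply ContinuousAt.continuousWithinAt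
    by_cases h : z = (Real.exp c - 1 : ℝ)
    · rw [h]; exact continuousAt_logKernelReg_self c
    · refine ContinuousAt.congr ?_ (logKernelReg_eventuallyEq h).symm
      exact (continuousAt_id.sub continuousAt_const).mul (continuousAt_logKernel hz h)

lemma continuousOn_sphere_logKernel {c : ℝ} (hc : c < 0 ∨ Real.log 2 < c) :
    ContinuousOn (logKernel c) (Metric.sphere 0 1) := by
  rcases hc with hc | hc
  · intro z hz
    rw [mem_sphere_zero_iff_norm] at hz
    refine (continuousAt_logKernel hz.le ?_).continuousWithinAt
    rintro rfl
    exact (abs_exp_sub_one_lt hc).ne hz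
  · refine (diffContOnCl_logKernel hc).continuousOn_ball.mono Metric.sphere_subset_closedBall

lemma circleIntegral_logKernel_of_log_two_lt {c : ℝ} (hc : Real.log 2 < c) :
    (∮ z in C(0, 1), (1 - 1 / z ^ 2) * logKernel c z) = 2 * π * Complex.I * (1 / (c : ℂ) ^ 2) := by
  have hf := diffContOnCl_logKernel hc
  have hc0 : c ≠ 0 := by have := Real.log_pos one_lt_two; linarith
  have h1 := hf.circleIntegral_eq_zero zero_le_one
  have h2 := hf.deriv_eq_smul_circleIntegral one_pos
  have hcont := continuousOn_sphere_logKernel (Or.inr hc)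
  have hne : ∀ z ∈ Metric.sphere (0:ℂ) 1, z ^ 2 ≠ 0 := fun z hz => by
    have : z ≠ 0 := by rintro rfl; simp at hz
    exact pow_ne_zero _ this
  have hi1 : CircleIntegrable (logKernel c) 0 1 := hcont.circleIntegrable zero_le_one
  have hi2 : CircleIntegrable (fun z : ℂ => (1 / (z - 0) ^ 2) • logKernel c z) 0 1 := by
    refine ContinuousOn.circleIntegrable zero_le_one ?_
    simp only [sub_zero]
    exact (continuousOn_const.div (continuousOn_id.pow 2) hne).smul hcont
  have h3 := circleIntegral.integral_sub hi1 hi2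
  rw [h1, h2, (hasDerivAt_logKernel_zero hc0).deriv] at h3
  simp only [sub_zero, smul_eq_mul] at h3
  calc _ = ∮ z in C(0, 1), (logKernel c z - 1 / z ^ 2 * logKernel c z) := by
        congr 1; ext z; ring
    _ = _ := by rw [h3]; ring

lemma circleIntegral_linear_combination {f g h : ℂ → ℂ} {z₀ : ℂ} {R : ℝ}
    (hf : CircleIntegrable f z₀ R) (hg : CircleIntegrable g z₀ R) (hh : CircleIntegrable h z₀ R)
    (a b c : ℂ) : (∮ z in C(z₀, R), (a • f z + b • g z + c • h z)) =
      a • (∮ z in C(z₀, R), f z) + b • (∮ z in C(z₀, R), g z) + c • (∮ z in C(z₀, R), h z) := by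
  have hf' : CircleIntegrable (fun z => a • f z) z₀ R := hf.const_smul
  have hg' : CircleIntegrable (fun z => b • g z) z₀ R := hg.const_smul
  have hh' : CircleIntegrable (fun z => c • h z) z₀ R := hh.const_smul
  have h1 := circleIntegral.integral_add hf' hg'
  have h2 := circleIntegral.integral_add (hf'.add hg') hh'
  simp only [Pi.add_apply] at h2
  rw [h2, h1, circleIntegral.integral_smul, circleIntegral.integral_smul,
    circleIntegral.integral_smul]

lemma circleIntegral_logKernel_of_neg {c : ℝ} (hc : c < 0) :
    (∮ z in C(0, 1), (1 - 1 / z ^ 2) * logKernel c z) = 2 * π * Complex.I *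
      ((1 / c ^ 2 + Real.exp c - Real.exp c / (Real.exp c - 1) ^ 2 : ℝ) : ℂ) := by
  have hf := diffContOnCl_logKernelReg hc
  have hpn := abs_exp_sub_one_lt hc
  have hp0 : ((Real.exp c - 1 : ℝ) : ℂ) ≠ 0 := by
    have := Real.exp_lt_one_iff.2 hc
    exact_mod_cast (by linarith : Real.exp c - 1 < 0).ne
  have hc0 : (c : ℂ) ≠ 0 := by exact_mod_cast hc.ne
  have h1 := hf.circleIntegral_sub_inv_smul (mem_ball_zero_iff.2 hpn)
  have h2 := hf.circleIntegral_sub_inv_smul (Metric.mem_ball_self one_pos)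
  have h3 := hf.deriv_eq_smul_circleIntegral one_pos
  have hGp : logKernelReg c (Real.exp c - 1 : ℝ) = Real.exp c := Function.update_self _ _ _
  have hG : ∀ z : ℂ, z ≠ (Real.exp c - 1 : ℝ) →
    logKernelReg c z = (z - (Real.exp c - 1 : ℝ)) * logKernel c z :=
    fun z hz => Function.update_of_ne hz _ _
  have hd : deriv (logKernelReg c) 0 = -(c : ℂ)⁻¹ + (Real.exp c - 1 : ℝ) / (c : ℂ) ^ 2 := by
    rw [(logKernelReg_eventuallyEq hp0.symm).deriv_eq]
    have := ((hasDerivAt_id (0:ℂ)).sub_const ((Real.exp c - 1 : ℝ) : ℂ)).mul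
      (hasDerivAt_logKernel_zero hc.ne)
    refine this.deriv.trans ?_
    simp only [id, logKernel_zero]
    ring
  rw [hd] at h3
  rw [hG 0 hp0.symm, logKernel_zero] at h2
  rw [hGp] at h1
  set p : ℂ := ((Real.exp c - 1 : ℝ) : ℂ) with hp
  have hcont : ContinuousOn (logKernelReg c) (Metric.sphere 0 1) :=
    hf.continuousOn_ball.mono Metric.sphere_subset_closedBall
  have hnp : ∀ z ∈ Metric.sphere (0:ℂ) 1, z - p ≠ 0 := fun z hz h => by
    rw [mem_sphere_zero_iff_norm, sub_eq_zero.1 h] at hz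
    exact hpn.ne hz
  have hn0 : ∀ z ∈ Metric.sphere (0:ℂ) 1, z - 0 ≠ 0 := fun z hz h => by
    rw [sub_zero] at h; rw [h] at hz; simp at hz
  have hcs : ∀ q : ℂ, ContinuousOn (fun z : ℂ => z - q) (Metric.sphere 0 1) := fun q => by fun_prop
  have hi1 : CircleIntegrable (fun z : ℂ => (z - p)⁻¹ • logKernelReg c z) 0 1 :=
    (((hcs p).inv₀ hnp).smul hcont).circleIntegrable zero_le_one
  have hi2 : CircleIntegrable (fun z : ℂ => (z - 0)⁻¹ • logKernelReg c z) 0 1 :=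
    (((hcs 0).inv₀ hn0).smul hcont).circleIntegrable zero_le_one
  have hi3 : CircleIntegrable (fun z : ℂ => (1 / (z - 0) ^ 2) • logKernelReg c z) 0 1 :=
    ((continuousOn_const.div ((hcs 0).pow 2) fun z hz => pow_ne_zero 2 (hn0 z hz)).smul
      hcont).circleIntegrable zero_le_one
  have e : (∮ z in C(0, 1), (1 - 1 / z ^ 2) * logKernel c z) =
      ∮ z in C(0, 1), ((1 - 1 / p ^ 2) • ((z - p)⁻¹ • logKernelReg c z)
        + (1 / p ^ 2) • ((z - 0)⁻¹ • logKernelReg c z)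
        + (1 / p) • ((1 / (z - 0) ^ 2) • logKernelReg c z)) := by
    refine circleIntegral.integral_congr zero_le_one fun z hz => ?_
    have ha := hnp z hz
    have hb := hn0 z hz
    rw [sub_zero] at hb
    simp only [smul_eq_mul, sub_zero, hG z (sub_ne_zero.1 ha)]
    field_simp
    ring
  rw [e, circleIntegral_linear_combination hi1 hi2 hi3, h1, h2, h3]
  have hE : (Real.exp c : ℂ) = p + 1 := by rw [hp]; push_cast; ring
  simp only [smul_eq_mul, Complex.ofReal_sub, Complex.ofReal_add, Complex.ofReal_div,
    Complex.ofReal_pow, Complex.ofReal_one, hE]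
  have : p + 1 - 1 = p := by ring
  rw [this]
  field_simp
  ring

lemma one_add_exp_two_mul (x : ℝ) :
    1 + Complex.exp ((2 * x : ℝ) * Complex.I) =
      (2 * Real.cos x : ℝ) * Complex.exp (x * Complex.I) := by
  push_cast
  rw [Complex.two_cos, add_mul, ← Complex.exp_add, ← Complex.exp_add, add_comm]
  congr 1
  · congr 1; ring
  · rw [neg_mul, neg_add_cancel, Complex.exp_zero]

lemma log_one_add_exp_two_mul {x : ℝ} (hx : x ∈ Ioo (-(π / 2)) (π / 2)) :
    Complex.log (1 + Complex.exp ((2 * x : ℝ) * Complex.I)) =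
      (Real.log (2 * Real.cos x) : ℝ) + x * Complex.I := by
  have hcos : 0 < 2 * Real.cos x := by have := Real.cos_pos_of_mem_Ioo hx; linarith
  rw [one_add_exp_two_mul]
  conv_lhs => rw [← Real.exp_log hcos]
  rw [Complex.ofReal_exp, ← Complex.exp_add, Complex.log_exp]
  · simp; linarith [hx.1, Real.pi_pos]
  · simp; linarith [hx.2, Real.pi_pos]

lemma im_logKernel_exp_two_mul (c : ℝ) {x : ℝ} (hx : x ∈ Ioo (-(π / 2)) (π / 2)) :
    (logKernel c (Complex.exp ((2 * x : ℝ) * Complex.I))).im =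
      -(x / ((Real.log (2 * Real.cos x) - c) ^ 2 + x ^ 2)) := by
  have hcos : 0 < 2 * Real.cos x := by have := Real.cos_pos_of_mem_Ioo hx; linarith
  have hne : Complex.exp ((2 * x : ℝ) * Complex.I) ≠ -1 := by
    intro h
    have h1 := one_add_exp_two_mul x
    rw [h, add_neg_cancel] at h1
    exact mul_ne_zero (by exact_mod_cast hcos.ne') (Complex.exp_ne_zero _) h1.symm
  rw [logKernel, if_neg hne, log_one_add_exp_two_mul hx, Complex.inv_im, Complex.normSq_apply]
  simp
  ring

lemma logKernel_conj (c : ℝ) {z : ℂ} (hz : ‖z‖ ≤ 1) :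
    logKernel c (starRingEnd ℂ z) = starRingEnd ℂ (logKernel c z) := by
  by_cases h : z = -1
  · simp [h, logKernel]
  · have h' : starRingEnd ℂ z ≠ -1 := fun h' => h (by
      rw [← Complex.conj_conj z, h', map_neg, map_one])
    have harg := Complex.mem_slitPlane_iff_arg.1 (one_add_mem_slitPlane hz h)
    rw [logKernel, logKernel, if_neg h, if_neg h', map_inv₀, map_sub, Complex.conj_ofReal,
      ← Complex.log_conj _ harg.1, map_add, map_one]

/-- The integral over a quarter period which corresponds to a single pole of the cotangent. -/
noncomputable def poleIntegral (c : ℝ) : ℝ :=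
  ∫ x in (0:ℝ)..(π / 2),
    Real.sin (2 * x) * (x / ((Real.log (2 * Real.cos x) - c) ^ 2 + x ^ 2))

lemma integral_zero_two_pi_of_symm {φ : ℝ → ℝ} (hφ : IntervalIntegrable φ volume 0 (2 * π))
    (hs : ∀ θ, φ (2 * π - θ) = φ θ) :
    ∫ θ in (0:ℝ)..(2 * π), φ θ = 4 * ∫ x in (0:ℝ)..(π / 2), φ (2 * x) := by
  have hpi := Real.pi_pos
  have h1 : IntervalIntegrable φ volume 0 π :=
    hφ.mono_set (by
      rw [uIcc_of_le (by positivity), uIcc_of_le (by positivity)]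
      exact Icc_subset_Icc le_rfl (by linarith))
  have h2 : IntervalIntegrable φ volume π (2 * π) :=
    hφ.mono_set (by
      rw [uIcc_of_le (by linarith), uIcc_of_le (by positivity)]
      exact Icc_subset_Icc (by linarith) le_rfl)
  have h3 : ∫ θ in π..(2 * π), φ θ = ∫ θ in (0:ℝ)..π, φ θ := by
    have := intervalIntegral.integral_comp_sub_left (a := 0) (b := π) φ (2 * π)
    simp only [hs, sub_zero] at this
    rw [this]
    congr 1
    ring
  have h4 := intervalIntegral.integral_comp_mul_left (a := 0) (b := π / 2) φ (two_ne_zero)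
  rw [← intervalIntegral.integral_add_adjacent_intervals h1 h2, h3, h4, mul_zero,
    mul_div_cancel₀ _ (two_ne_zero), smul_eq_mul]
  ring

lemma im_circleIntegral_logKernel {c : ℝ} (hc : c < 0 ∨ Real.log 2 < c) :
    (∮ z in C(0, 1), (1 - 1 / z ^ 2) * logKernel c z).im = 8 * poleIntegral c := by
  set φ : ℝ → ℝ := fun θ => Real.sin θ * (logKernel c (Complex.exp (θ * Complex.I))).im with hφ
  have hcont : Continuous fun θ : ℝ => logKernel c (Complex.exp (θ * Complex.I)) := by
    refine (continuousOn_sphere_logKernel hc).comp_continuous (by fun_prop) fun θ => ?_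
    rw [mem_sphere_zero_iff_norm, Complex.norm_exp_ofReal_mul_I]
  have hφc : Continuous φ := Real.continuous_sin.mul (Complex.continuous_im.comp hcont)
  have hcirc : (∮ z in C(0, 1), (1 - 1 / z ^ 2) * logKernel c z) =
      ∫ θ in (0:ℝ)..(2 * π),
        (-2 : ℂ) * (Real.sin θ * logKernel c (Complex.exp (θ * Complex.I))) := by
    rw [circleIntegral]
    congr 1
    ext θ
    simp only [deriv_circleMap, circleMap, zero_add, Complex.ofReal_one, one_mul, smul_eq_mul]
    have h1 : Complex.exp (-θ * Complex.I) = (Complex.exp (θ * Complex.I))⁻¹ := by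
      rw [neg_mul, Complex.exp_neg]
    have h2 := Complex.two_sin (θ : ℂ)
    rw [h1] at h2
    have h3 := Complex.exp_ne_zero (θ * Complex.I)
    rw [Complex.ofReal_sin]
    generalize Complex.exp (θ * Complex.I) = e at *
    have h4 : -2 * Complex.sin θ = e * Complex.I * (1 - 1 / e ^ 2) := by
      rw [neg_mul, h2]
      field_simp
      ring
    linear_combination (-logKernel c e) * h4
  have hsymm : ∀ θ, φ (2 * π - θ) = φ θ := by
    intro θ
    have h1 : Complex.exp ((2 * π - θ : ℝ) * Complex.I) =
        starRingEnd ℂ (Complex.exp (θ * Complex.I)) := by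
      rw [← Complex.exp_conj, map_mul, Complex.conj_I, Complex.conj_ofReal, Complex.ofReal_sub,
        sub_mul, sub_eq_add_neg, Complex.exp_add]
      push_cast
      rw [Complex.exp_two_pi_mul_I, one_mul, mul_neg]
    simp only [hφ]
    rw [h1, logKernel_conj c (Complex.norm_exp_ofReal_mul_I θ).le, Real.sin_two_pi_sub,
      Complex.conj_im]
    ring
  have him : (∮ z in C(0, 1), (1 - 1 / z ^ 2) * logKernel c z).im =
      ∫ θ in (0:ℝ)..(2 * π), (-2) * φ θ := by
    rw [hcirc]
    have h := intervalIntegral.intervalIntegral_im (𝕜 := ℂ) (μ := volume) (a := 0) (b := 2 * π)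
      (f := fun θ : ℝ => (-2 : ℂ) * (Real.sin θ * logKernel c (Complex.exp (θ * Complex.I))))
      (by apply Continuous.intervalIntegrable; fun_prop)
    simp only [RCLike.im_to_complex] at h
    rw [← h]
    congr 1
    ext θ
    rw [neg_mul, Complex.neg_im, ← Complex.ofReal_ofNat, Complex.im_ofReal_mul,
      Complex.im_ofReal_mul, neg_mul]
  rw [him, intervalIntegral.integral_const_mul,
    integral_zero_two_pi_of_symm (hφc.intervalIntegrable _ _) hsymm, poleIntegral]
  have : ∫ x in (0:ℝ)..(π / 2), φ (2 * x) = ∫ x in (0:ℝ)..(π / 2),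
      -(Real.sin (2 * x) * (x / ((Real.log (2 * Real.cos x) - c) ^ 2 + x ^ 2))) := by
    refine intervalIntegral.integral_congr fun x hx => ?_
    rw [uIcc_of_le (by positivity)] at hx
    simp only [hφ]
    rcases hx.2.eq_or_lt with h | h
    · have : 2 * x = π := by linarith
      simp [this]
    · rw [im_logKernel_exp_two_mul c ⟨by linarith [hx.1, Real.pi_pos], h⟩]
      ring
  rw [this, intervalIntegral.integral_neg]
  ring

lemma poleIntegral_of_log_two_lt {c : ℝ} (hc : Real.log 2 < c) :
    poleIntegral c = π / 4 * (1 / c ^ 2) := by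
  have h := im_circleIntegral_logKernel (Or.inr hc)
  rw [circleIntegral_logKernel_of_log_two_lt hc] at h
  have h2 : (2 * π * Complex.I * (1 / (c : ℂ) ^ 2)) =
      ((2 * π * (1 / c ^ 2) : ℝ) : ℂ) * Complex.I := by push_cast; ring
  rw [h2, Complex.mul_I_im, Complex.ofReal_re] at h
  linarith

lemma poleIntegral_of_neg {c : ℝ} (hc : c < 0) :
    poleIntegral c =
      π / 4 * (1 / c ^ 2 + Real.exp c - Real.exp c / (Real.exp c - 1) ^ 2) := by
  have h := im_circleIntegral_logKernel (Or.inl hc)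
  rw [circleIntegral_logKernel_of_neg hc] at h
  rw [mul_right_comm, Complex.mul_I_im, ← Complex.ofReal_ofNat, ← Complex.ofReal_mul,
    ← Complex.ofReal_mul, Complex.ofReal_re] at h
  linarith

lemma measurable_poleIntegrand (c : ℝ) : Measurable fun x : ℝ =>
    Real.sin (2 * x) * (x / ((Real.log (2 * Real.cos x) - c) ^ 2 + x ^ 2)) := by
  fun_prop

lemma norm_poleIntegrand_le (c x : ℝ) :
    ‖Real.sin (2 * x) * (x / ((Real.log (2 * Real.cos x) - c) ^ 2 + x ^ 2))‖ ≤ 2 := by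
  set y := Real.log (2 * Real.cos x) - c
  rw [norm_mul, norm_div, Real.norm_eq_abs, Real.norm_eq_abs, Real.norm_eq_abs,
    abs_of_nonneg (by positivity : 0 ≤ y ^ 2 + x ^ 2)]
  rcases eq_or_ne x 0 with rfl | hx
  · simp
  have hx' : 0 < x ^ 2 := by positivity
  have h1 : |Real.sin (2 * x)| ≤ 2 * |x| := by
    simpa [abs_mul] using Real.abs_sin_le_abs (x := 2 * x)
  rw [← mul_div_assoc, div_le_iff₀ (by positivity)]
  calc |Real.sin (2 * x)| * |x| ≤ 2 * |x| * |x| := by gcongr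
    _ = 2 * x ^ 2 := by rw [mul_assoc, abs_mul_abs_self]; ring
    _ ≤ 2 * (y ^ 2 + x ^ 2) := by nlinarith [sq_nonneg y]

lemma poleIntegrand_nonneg (c : ℝ) {x : ℝ} (hx : x ∈ Ioc 0 (π / 2)) :
    0 ≤ Real.sin (2 * x) * (x / ((Real.log (2 * Real.cos x) - c) ^ 2 + x ^ 2)) := by
  have h1 : 0 ≤ Real.sin (2 * x) :=
    Real.sin_nonneg_of_nonneg_of_le_pi (by linarith [hx.1]) (by linarith [hx.2])
  have h2 := hx.1
  positivity

lemma integrableOn_poleIntegrand (c : ℝ) : IntegrableOn (fun x : ℝ =>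
    Real.sin (2 * x) * (x / ((Real.log (2 * Real.cos x) - c) ^ 2 + x ^ 2)))
    (Ioc 0 (π / 2)) :=
  Measure.integrableOn_of_bounded (M := 2) measure_Ioc_lt_top.ne
    (measurable_poleIntegrand c).aestronglyMeasurable
    (ae_of_all _ fun x => norm_poleIntegrand_le c x)

lemma continuousAt_poleIntegral_zero : ContinuousAt poleIntegral 0 := by
  unfold poleIntegral
  refine intervalIntegral.continuousAt_of_dominated_interval (bound := fun _ => 2)
    (Eventually.of_forall fun c => (measurable_poleIntegrand c).aestronglyMeasurable)
    (Eventually.of_forall fun c => ae_of_all _ fun x _ => norm_poleIntegrand_le c x)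
    intervalIntegrable_const (ae_of_all _ fun x hx => ?_)
  rw [uIoc_of_le (by positivity)] at hx
  have := hx.1
  refine continuousAt_const.mul (continuousAt_const.div ?_ (by positivity))
  fun_prop

lemma tendsto_inv_sq_add_exp_sub :
    Tendsto (fun c : ℝ => 1 / c ^ 2 + Real.exp c - Real.exp c / (Real.exp c - 1) ^ 2)
      (𝓝[<] 0) (𝓝 (13 / 12)) := by
  set s : ℝ → ℝ := fun c => (Real.exp c - (1 + c + c ^ 2 / 2 + c ^ 3 / 6)) / c ^ 3 with hs
  have hs0 : Tendsto s (𝓝[<] 0) (𝓝 0) := by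
    have h := (Real.exp_sub_sum_range_succ_isLittleO_pow 3).tendsto_div_nhds_zero
    refine (h.mono_left nhdsWithin_le_nhds).congr fun c => ?_
    simp [hs, Finset.sum_range_succ, Nat.factorial]
  have hid : Tendsto (fun c : ℝ => c) (𝓝[<] 0) (𝓝 0) := tendsto_id.mono_left nhdsWithin_le_nhds
  have hexp : Tendsto Real.exp (𝓝[<] 0) (𝓝 1) := by
    simpa using (Real.continuous_exp.tendsto 0).mono_left nhdsWithin_le_nhds
  have ht : Tendsto (fun c => 1 / 2 + c / 6 + c * s c) (𝓝[<] 0) (𝓝 (1 / 2)) := by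
    simpa only [zero_div, mul_zero, add_zero] using
      ((hid.div_const 6).const_add (1 / 2)).add (hid.mul hs0)
  have hlim := (((((hs0.const_mul 2).const_add (1 / 3)).add (ht.pow 2)).sub ht).div
    (((hid.mul ht).const_add 1).pow 2) (by norm_num)).add hexp
  have hval : (1 / 3 + 2 * 0 + (1 / 2) ^ 2 - 1 / 2) / (1 + 0 * (1 / 2)) ^ 2 + 1 =
      (13 / 12 : ℝ) := by norm_num
  rw [hval] at hlim
  refine hlim.congr' ?_
  filter_upwards [self_mem_nhdsWithin] with c hc
  have hc0 : c ≠ 0 := (show c < 0 from hc).ne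
  have hE : Real.exp c = 1 + c * (1 + c * (1 / 2 + c / 6 + c * s c)) := by
    simp only [hs]; field_simp; ring
  have hu : 1 + c * (1 / 2 + c / 6 + c * s c) ≠ 0 := by
    intro h
    rw [h, mul_zero, add_zero, Real.exp_eq_one_iff] at hE
    exact hc0 hE
  simp only [Pi.div_apply]
  generalize s c = r at *
  have h1 : Real.exp c / (Real.exp c - 1) ^ 2 =
      (1 + c * (1 + c * (1 / 2 + c / 6 + c * r))) /
        (c ^ 2 * (1 + c * (1 / 2 + c / 6 + c * r)) ^ 2) := by
    rw [hE]; congr 1; ring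
  have h2 : (1 : ℝ) / c ^ 2 = (1 + c * (1 / 2 + c / 6 + c * r)) ^ 2 /
      (c ^ 2 * (1 + c * (1 / 2 + c / 6 + c * r)) ^ 2) := by
    rw [div_eq_div_iff (by positivity) (by positivity)]; ring
  rw [h1, h2, add_sub_right_comm _ (Real.exp c), ← sub_div]
  congr 1
  rw [div_eq_div_iff (by positivity) (by positivity)]
  ring

lemma poleIntegral_zero : poleIntegral 0 = π / 4 * (13 / 12) := by
  have h1 : Tendsto poleIntegral (𝓝[<] 0) (𝓝 (poleIntegral 0)) :=
    continuousAt_poleIntegral_zero.tendsto.mono_left nhdsWithin_le_nhds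
  refine tendsto_nhds_unique h1 ((tendsto_inv_sq_add_exp_sub.const_mul (π / 4)).congr' ?_)
  filter_upwards [self_mem_nhdsWithin] with c hc
  exact (poleIntegral_of_neg hc).symm

lemma exp_div_exp_sub_one_sq (c : ℝ) :
    Real.exp c / (Real.exp c - 1) ^ 2 = 1 / (4 * Real.sinh (c / 2) ^ 2) := by
  have h : Real.exp c - 1 = 2 * Real.sinh (c / 2) * Real.exp (c / 2) := by
    rw [Real.sinh_eq, mul_div_cancel₀ _ two_ne_zero, sub_mul, ← Real.exp_add, ← Real.exp_add]
    simp
  have h2 : Real.exp c = Real.exp (c / 2) ^ 2 := by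
    rw [← Real.exp_nat_mul]; congr 1; push_cast; ring
  have h3 := Real.exp_ne_zero (c / 2)
  rw [h, h2, mul_pow, div_mul_cancel_right₀ (pow_ne_zero 2 h3), mul_pow, one_div]
  norm_num

lemma poleIntegral_add_poleIntegral_neg {c : ℝ} (hc : Real.log 2 < c) :
    poleIntegral c + poleIntegral (-c) =
      π / 4 * (2 / c ^ 2 + Real.exp (-c) - 1 / (4 * Real.sinh (c / 2) ^ 2)) := by
  have h0 := Real.log_pos one_lt_two
  rw [poleIntegral_of_log_two_lt hc, poleIntegral_of_neg (by linarith),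
    exp_div_exp_sub_one_sq, neg_div, Real.sinh_neg, neg_sq, neg_sq]
  ring

lemma im_cot_div_two (a b : ℝ) (ha : 0 < a) :
    (Complex.cot ((b + a * Complex.I) / 2)).im =
      -(Real.sinh a / (Real.cosh a - Real.cos b)) := by
  have h1 : 2 * Complex.I * ((b + a * Complex.I) / 2) = ((-a : ℝ) : ℂ) + b * Complex.I := by
    push_cast
    linear_combination a * Complex.I_mul_I
  have hre : (Complex.exp (((-a : ℝ) : ℂ) + b * Complex.I)).re =
      Real.exp (-a) * Real.cos b := by simp [Complex.exp_re]
  have him : (Complex.exp (((-a : ℝ) : ℂ) + b * Complex.I)).im =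
      Real.exp (-a) * Real.sin b := by simp [Complex.exp_im]
  have hpos : 0 < Real.cosh a - Real.cos b := by
    linarith [Real.one_lt_cosh.2 ha.ne', Real.cos_le_one b]
  have hinv : Real.exp a * Real.exp (-a) = 1 := by rw [← Real.exp_add]; simp
  have hcosh : 2 * Real.exp (-a) * Real.cosh a = 1 + Real.exp (-a) ^ 2 := by
    rw [Real.cosh_eq]; linear_combination hinv
  have hsinh : 2 * Real.exp (-a) * Real.sinh a = 1 - Real.exp (-a) ^ 2 := by
    rw [Real.sinh_eq]; linear_combination hinv
  have hr := Real.exp_pos (-a)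
  rw [Complex.cot_eq_exp_ratio, h1, Complex.div_im, Complex.normSq_apply]
  simp only [Complex.mul_re, Complex.mul_im, Complex.I_re, Complex.I_im, Complex.sub_re,
    Complex.sub_im, Complex.one_re, Complex.one_im, Complex.add_re, Complex.add_im, hre, him]
  generalize Real.exp (-a) = r at *
  have hN : (0 * (1 - r * Real.cos b) - 1 * (0 - r * Real.sin b)) *
        (0 * (1 - r * Real.cos b) - 1 * (0 - r * Real.sin b)) +
      (0 * (0 - r * Real.sin b) + 1 * (1 - r * Real.cos b)) *
        (0 * (0 - r * Real.sin b) + 1 * (1 - r * Real.cos b)) =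
      2 * r * (Real.cosh a - Real.cos b) := by
    linear_combination r ^ 2 * Real.sin_sq_add_cos_sq b - hcosh
  rw [hN, ← sub_div, ← neg_div, div_eq_div_iff (by positivity) hpos.ne']
  linear_combination (Real.cosh a - Real.cos b) * (r ^ 2 * Real.sin_sq_add_cos_sq b + hsinh)

lemma im_one_div_sub_div {α c x L : ℝ} (hα : α ≠ 0) :
    (1 / (((L : ℂ) + x * Complex.I) / (2 * π * α) - c)).im =
      -(2 * π * α) * (x / ((L - 2 * π * α * c) ^ 2 + x ^ 2)) := by
  have hK : 2 * π * α ≠ 0 := by positivity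
  have h1 : ((L : ℂ) + x * Complex.I) / (2 * π * α) - c =
      (((L - 2 * π * α * c : ℝ) : ℂ) + x * Complex.I) / ((2 * π * α : ℝ) : ℂ) := by
    have : ((2 * π * α : ℝ) : ℂ) ≠ 0 := by exact_mod_cast hK
    rw [show (2 * π * α : ℂ) = ((2 * π * α : ℝ) : ℂ) by push_cast; rfl, div_sub' this]
    push_cast
    ring
  rw [h1, one_div_div, div_eq_mul_inv, Complex.im_ofReal_mul, Complex.inv_im,
    Complex.normSq_add_mul_I]
  simp
  ring

lemma hasSum_sinh_div_cosh_sub_cos {α x : ℝ} (hα : 0 < α) (hx : 0 < x) (L : ℝ) :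
    HasSum (fun n : ℕ => x / ((L - 2 * π * α * (n + 1)) ^ 2 + x ^ 2)
        + x / ((L - -(2 * π * α * (n + 1))) ^ 2 + x ^ 2))
      (Real.sinh (x / α) / (Real.cosh (x / α) - Real.cos (L / α)) / (2 * α)
        - x / ((L - 0) ^ 2 + x ^ 2)) := by
  set z : ℂ := ((L : ℂ) + x * Complex.I) / (2 * π * α) with hzdef
  have hK : 2 * π * α ≠ 0 := by positivity
  have hz : z ∈ Complex.integerComplement := by
    rw [Complex.mem_integerComplement_iff]
    rintro ⟨n, hn⟩
    have : z.im = x / (2 * π * α) := by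
      have : z = ((L / (2 * π * α) : ℝ) : ℂ) + (x / (2 * π * α) : ℝ) * Complex.I := by
        rw [hzdef]; push_cast; ring
      rw [this]; simp [-Complex.ofReal_div]
    rw [← hn, Complex.intCast_im] at this
    exact (div_pos hx (by positivity)).ne this
  have h := (summable_cotTerm hz).hasSum
  rw [show (∑' n : ℕ, cotTerm z n) = _ from (cot_series_rep' hz).symm] at h
  have h' := (Complex.hasSum_im h).mul_left (-(2 * π * α)⁻¹)
  refine (congrArg₂ (fun f s => HasSum f s _) (funext fun n => ?_) ?_).mpr h'
  · have e1 := im_one_div_sub_div (c := n + 1) (x := x) (L := L) hα.ne'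
    have e2 := im_one_div_sub_div (c := -(n + 1)) (x := x) (L := L) hα.ne'
    rw [← hzdef] at e1 e2
    push_cast at e1 e2
    rw [sub_neg_eq_add] at e2
    rw [cotTerm, Complex.add_im, e1, e2, mul_neg (2 * π * α)]
    field_simp
    ring
  · have e0 := im_one_div_sub_div (c := 0) (x := x) (L := L) hα.ne'
    rw [← hzdef, Complex.ofReal_zero, sub_zero, mul_zero] at e0
    have hcot : (π : ℂ) * z = (((L / α : ℝ) : ℂ) + ((x / α : ℝ) : ℂ) * Complex.I) / 2 := by
      have h1 : (α : ℂ) ≠ 0 := by exact_mod_cast hα.ne'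
      have h2 : (π : ℂ) ≠ 0 := by exact_mod_cast Real.pi_ne_zero
      rw [hzdef]; push_cast; field_simp
    rw [Complex.sub_im, e0, Complex.im_ofReal_mul, hcot, im_cot_div_two _ _ (by positivity)]
    field_simp
    ring

theorem stmt_9 (α : ℝ) (hα : Real.log 2 / (2*π) < α) :
    ∫ x in (0:ℝ)..(π/2),
        (Real.sin (2*x) * Real.sinh (x/α))
          / (Real.cosh (x/α) - Real.cos (Real.log (2 * Real.cos x) / α))
      = π / (24*α) + 13*π*α/24 + π*α / (2 * (Real.exp (2*π*α) - 1))
        - (π*α/8) * ∑' n : ℕ, 1 / (Real.sinh (π*α*(n+1)))^2 := by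
  have hpi := Real.pi_pos
  have hα0 : 0 < α := lt_trans (div_pos (Real.log_pos one_lt_two) (by positivity)) hα
  have hlog : Real.log 2 < 2 * π * α := by
    rw [div_lt_iff₀ (by positivity)] at hα; linarith
  set g : ℝ → ℝ → ℝ := fun c x =>
    Real.sin (2 * x) * (x / ((Real.log (2 * Real.cos x) - c) ^ 2 + x ^ 2)) with hg
  set F : ℕ → ℝ → ℝ := fun n x =>
    g (2 * π * α * (n + 1)) x + g (-(2 * π * α * (n + 1))) x with hF
  set T : ℕ → ℝ → ℝ := fun n => Nat.casesOn n (g 0) F with hT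
  have hFint : ∀ n, IntegrableOn (F n) (Ioc 0 (π / 2)) := fun n =>
    (integrableOn_poleIntegrand _).add (integrableOn_poleIntegrand _)
  have hgint : ∀ c, ∫ x in Ioc 0 (π / 2), g c x = poleIntegral c := fun c => by
    rw [poleIntegral, intervalIntegral.integral_of_le (by positivity)]
  have hc : ∀ n : ℕ, Real.log 2 < 2 * π * α * (n + 1) := fun n => by
    have : (0:ℝ) ≤ n := n.cast_nonneg
    nlinarith [mul_nonneg (by positivity : 0 ≤ 2 * π * α) this]
  have hFval : ∀ n : ℕ, ∫ x in Ioc 0 (π / 2), F n x =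
      1 / (8 * π * α ^ 2) * (1 / ((n + 1 : ℕ) : ℝ) ^ 2) + π / 4 * Real.exp (-(2 * π * α)) ^ (n + 1)
        - π / 16 * (1 / Real.sinh (π * α * (n + 1)) ^ 2) := fun n => by
    simp only [hF]
    rw [integral_add (integrableOn_poleIntegrand _) (integrableOn_poleIntegrand _), hgint, hgint,
      poleIntegral_add_poleIntegral_neg (hc n), ← Real.exp_nat_mul]
    have e1 : 2 * π * α * (n + 1 : ℝ) / 2 = π * α * (n + 1) := by ring
    have e2 : -(2 * π * α * (n + 1 : ℝ)) = ((n + 1 : ℕ) : ℝ) * -(2 * π * α) := by push_cast; ring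
    rw [e1, e2]
    have hn : (n + 1 : ℝ) ≠ 0 := by positivity
    push_cast
    field_simp
    ring
  have hzeta : HasSum (fun n : ℕ => 1 / ((n + 1 : ℕ) : ℝ) ^ 2) (π ^ 2 / 6) := by
    have := (hasSum_nat_add_iff' 1).2 hasSum_zeta_two
    simpa using this
  have hgeom : HasSum (fun n : ℕ => Real.exp (-(2 * π * α)) ^ (n + 1))
      (1 / (Real.exp (2 * π * α) - 1)) := by
    have hq : Real.exp (-(2 * π * α)) < 1 := Real.exp_lt_one_iff.2 (by
      have : 0 < 2 * π * α := by positivity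
      linarith)
    have := (hasSum_geometric_of_lt_one (Real.exp_pos _).le hq).mul_left (Real.exp (-(2 * π * α)))
    simp only [pow_succ']
    rwa [show Real.exp (-(2 * π * α)) * (1 - Real.exp (-(2 * π * α)))⁻¹ =
      1 / (Real.exp (2 * π * α) - 1) from ?_] at this
    have h1 : 1 < Real.exp (2 * π * α) := Real.one_lt_exp_iff.2 (by positivity)
    have h2 : Real.exp (2 * π * α) - 1 ≠ 0 := by linarith
    rw [Real.exp_neg]
    field_simp
  have hsinh : Summable fun n : ℕ => 1 / Real.sinh (π * α * (n + 1)) ^ 2 := by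
    refine Summable.of_nonneg_of_le (fun n => by positivity) (fun n => ?_)
      (hzeta.summable.mul_left (1 / (π * α) ^ 2))
    have h1 : π * α * (n + 1) ≤ Real.sinh (π * α * (n + 1)) := Real.self_le_sinh_iff.2 (by positivity)
    rw [one_div_mul_one_div, ← mul_pow]
    push_cast
    gcongr
  have hsum := ((hzeta.mul_left (1 / (8 * π * α ^ 2))).add (hgeom.mul_left (π / 4))).sub
    (hsinh.hasSum.mul_left (π / 16))
  have hTint : ∀ n, IntegrableOn (T n) (Ioc 0 (π / 2))
    | 0 => integrableOn_poleIntegrand 0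
    | n + 1 => hFint n
  have hTnn : ∀ n, ∀ x ∈ Ioc 0 (π / 2), 0 ≤ T n x
    | 0, x, hx => poleIntegrand_nonneg 0 hx
    | n + 1, x, hx => add_nonneg (poleIntegrand_nonneg _ hx) (poleIntegrand_nonneg _ hx)
  have hnorm : ∀ n, ∫ x in Ioc 0 (π / 2), ‖T n x‖ = ∫ x in Ioc 0 (π / 2), T n x := fun n =>
    setIntegral_congr_fun measurableSet_Ioc fun x hx => Real.norm_of_nonneg (hTnn n x hx)
  have hTsum : HasSum (fun n => ∫ x in Ioc 0 (π / 2), T n x) _ :=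
    (hasSum_nat_add_iff 1).1 (by simpa only [hT, hFval] using hsum)
  have htsum := (hasSum_integral_of_summable_integral_norm hTint
    (by simpa only [hnorm] using hTsum.summable)).unique hTsum
  rw [Finset.sum_range_one, show (∫ x in Ioc 0 (π / 2), T 0 x) = _ from hgint 0,
    poleIntegral_zero] at htsum
  have hint : ∫ x in Ioc 0 (π / 2), (Real.sin (2*x) * Real.sinh (x/α))
          / (Real.cosh (x/α) - Real.cos (Real.log (2 * Real.cos x) / α)) =
      ∫ x in Ioc 0 (π / 2), 2 * α * ∑' n, T n x := by
    refine setIntegral_congr_fun measurableSet_Ioc fun x hx => ?_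
    have h := (hasSum_sinh_div_cosh_sub_cos hα0 hx.1 (Real.log (2 * Real.cos x))).mul_left
      (Real.sin (2 * x))
    have h' : HasSum (fun n => T n x) _ :=
      (hasSum_nat_add_iff 1).1 (by simpa only [hT, hF, hg, mul_add] using h)
    simp only [h'.tsum_eq]
    rw [Finset.sum_range_one, show T 0 x = g 0 x from rfl]
    simp only [hg]
    field_simp
    ring
  rw [intervalIntegral.integral_of_le (by positivity), hint, integral_const_mul, htsum]
  field_simp
  ring
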